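/- Let σ > 0 and let ρ : ℝ³ → ℝ be the Gaussian ρ(y) = (1/(σ³(2π)^{3/2})) e^{−|y|²/(2σ²)}. Then for every x ∈ ℝ³ with x ≠ 0, writing r = |x|, the Coulomb potential of ρ satisfies ∫_{ℝ³} (1/(4π|x−y|)) ρ(y) dy = erf(r/(√2 σ)) / (4π r). -/

import Mathlib

open MeasureTheory

/-- The error function `erf(t) = (2/√π) ∫₀^t e^{−u²} du`. -/
noncomputable def erf (t : ℝ) : ℝ :=
  (2 / Real.sqrt Real.pi) * ∫ u in (0 : ℝ)..t, Real.exp (-u ^ 2)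

open Real Set Filter Topology in
/-- The derivative of `t ↦ ∫₀^{a t / √(t² + b)} e^{−s²} ds`. -/
lemma hasDerivAt_integral_exp_neg_sq_comp {b : ℝ} (hb : 0 < b) (a t : ℝ) :
    HasDerivAt (fun t : ℝ => ∫ s in (0 : ℝ)..(a * (t / √(t ^ 2 + b))), exp (-s ^ 2))
      (exp (-(a ^ 2 * (t ^ 2 / (t ^ 2 + b)))) * (a * (b / ((t ^ 2 + b) * √(t ^ 2 + b))))) t := by
  have hpos : 0 < t ^ 2 + b := by positivity
  have hsq : √(t ^ 2 + b) ^ 2 = t ^ 2 + b := sq_sqrt hpos.le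
  have hs : 0 < √(t ^ 2 + b) := sqrt_pos.2 hpos
  have hcont : Continuous fun s : ℝ => exp (-s ^ 2) := by fun_prop
  have h1 : HasDerivAt (fun t : ℝ => √(t ^ 2 + b)) (t / √(t ^ 2 + b)) t := by
    have := ((hasDerivAt_pow 2 t).add_const b).sqrt hpos.ne'
    convert this using 1
    push_cast
    rw [pow_one, mul_div_mul_left _ _ two_ne_zero]
  have h2 : HasDerivAt (fun t : ℝ => a * (t / √(t ^ 2 + b)))
      (a * (b / ((t ^ 2 + b) * √(t ^ 2 + b)))) t := by
    refine (((hasDerivAt_id' t).div h1 hs.ne').const_mul a).congr_deriv ?_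
    rw [hsq]
    field_simp
    rw [hsq]
    ring
  have h3 := (hcont.integral_hasStrictDerivAt 0 (a * (t / √(t ^ 2 + b)))).hasDerivAt.comp t h2
  rw [mul_pow, div_pow, hsq] at h3
  exact h3

open Real Set Filter Topology in
lemma tendsto_div_sqrt_sq_add_atTop (b : ℝ) :
    Tendsto (fun t : ℝ => t / √(t ^ 2 + b)) atTop (𝓝 1) := by
  have h : Tendsto (fun t : ℝ => 1 / √(1 + b * (t ^ 2)⁻¹)) atTop (𝓝 1) := by
    have h0 : Tendsto (fun t : ℝ => (t ^ 2)⁻¹) atTop (𝓝 0) :=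
      tendsto_inv_atTop_zero.comp (tendsto_pow_atTop two_ne_zero)
    have h1 : Tendsto (fun t : ℝ => √(1 + b * (t ^ 2)⁻¹)) atTop (𝓝 1) := by
      simpa using ((h0.const_mul b).const_add 1).sqrt
    simpa using h1.inv₀ one_ne_zero
  refine h.congr' ?_
  filter_upwards [eventually_gt_atTop 0] with t ht
  have : t ^ 2 + b = t ^ 2 * (1 + b * (t ^ 2)⁻¹) := by field_simp
  rw [this, sqrt_mul (sq_nonneg t), sqrt_sq ht.le, div_mul_eq_div_div, div_self ht.ne']

open Real Set Filter Topology in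
lemma tendsto_integral_exp_neg_sq_comp (a b : ℝ) :
    Tendsto (fun t : ℝ => ∫ s in (0 : ℝ)..(a * (t / √(t ^ 2 + b))), exp (-s ^ 2)) atTop
      (𝓝 (∫ s in (0 : ℝ)..a, exp (-s ^ 2))) := by
  have hcont : Continuous fun s : ℝ => exp (-s ^ 2) := by fun_prop
  have h2 : Continuous fun u : ℝ => ∫ s in (0 : ℝ)..u, exp (-s ^ 2) :=
    intervalIntegral.continuous_primitive (fun _ _ => hcont.intervalIntegrable _ _) 0
  have h3 := (tendsto_div_sqrt_sq_add_atTop b).const_mul a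
  rw [mul_one] at h3
  exact (h2.tendsto a).comp h3

open Real in
/-- The integral of a product of two Gaussians in dimension three. -/
lemma integral_exp_mul_exp {b : ℝ} (hb : 0 < b) (t : ℝ) (x : EuclideanSpace ℝ (Fin 3)) :
    ∫ y, exp (-‖x - y‖ ^ 2 * t ^ 2) * exp (-b * ‖y‖ ^ 2) =
      (π / (t ^ 2 + b)) ^ ((3 : ℝ) / 2) * exp (-(b * ‖x‖ ^ 2 * (t ^ 2 / (t ^ 2 + b)))) := by
  have hpos : 0 < t ^ 2 + b := by positivity
  have h : ∀ y : EuclideanSpace ℝ (Fin 3), exp (-‖x - y‖ ^ 2 * t ^ 2) * exp (-b * ‖y‖ ^ 2) =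
      exp (-(t ^ 2 + b) * ‖y - (t ^ 2 / (t ^ 2 + b)) • x‖ ^ 2) *
        exp (-(b * ‖x‖ ^ 2 * (t ^ 2 / (t ^ 2 + b)))) := by
    intro y
    rw [← exp_add, ← exp_add, norm_sub_sq_real, norm_sub_sq_real, norm_smul, inner_smul_right,
      real_inner_comm x y, mul_pow, norm_eq_abs, sq_abs]
    congr 1
    field_simp
    ring
  simp_rw [h]
  rw [integral_mul_const,
    integral_sub_right_eq_self (fun y => exp (-(t ^ 2 + b) * ‖y‖ ^ 2)),
    GaussianFourier.integral_rexp_neg_mul_sq_norm hpos]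
  simp

open Real in
lemma rpow_three_halves {c : ℝ} (hc : 0 ≤ c) : c ^ ((3 : ℝ) / 2) = c * √c := by
  rw [sqrt_eq_rpow, show (3 : ℝ) / 2 = 1 + 1 / 2 by norm_num,
    rpow_add_of_nonneg hc zero_le_one (by norm_num), rpow_one]

open Real Set Filter Topology in
lemma integrableOn_and_integral_gaussian_product {a b : ℝ} (ha : 0 < a) (hb : 0 < b) :
    IntegrableOn (fun t : ℝ => (π / (t ^ 2 + b)) ^ ((3 : ℝ) / 2) *
        exp (-(a ^ 2 * (t ^ 2 / (t ^ 2 + b))))) (Ioi 0) ∧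
      ∫ t in Ioi (0 : ℝ), (π / (t ^ 2 + b)) ^ ((3 : ℝ) / 2) *
        exp (-(a ^ 2 * (t ^ 2 / (t ^ 2 + b)))) =
      π * √π / (a * b) * ∫ s in (0 : ℝ)..a, exp (-s ^ 2) := by
  have hfun : (fun t : ℝ => (π / (t ^ 2 + b)) ^ ((3 : ℝ) / 2) *
      exp (-(a ^ 2 * (t ^ 2 / (t ^ 2 + b))))) = fun t => π * √π / (a * b) *
      (exp (-(a ^ 2 * (t ^ 2 / (t ^ 2 + b)))) * (a * (b / ((t ^ 2 + b) * √(t ^ 2 + b))))) := by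
    funext t
    have hpos : 0 < t ^ 2 + b := by positivity
    have hs : 0 < √(t ^ 2 + b) := sqrt_pos.2 hpos
    rw [rpow_three_halves (by positivity), sqrt_div pi_pos.le]
    field_simp
  have hderiv := fun t (_ : t ∈ Ici (0 : ℝ)) => hasDerivAt_integral_exp_neg_sq_comp hb a t
  have hnonneg : ∀ t ∈ Ioi (0 : ℝ), 0 ≤ exp (-(a ^ 2 * (t ^ 2 / (t ^ 2 + b)))) *
      (a * (b / ((t ^ 2 + b) * √(t ^ 2 + b)))) := fun t _ => by positivity
  have hlim := tendsto_integral_exp_neg_sq_comp a b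
  rw [hfun]
  refine ⟨(integrableOn_Ioi_deriv_of_nonneg' hderiv hnonneg hlim).const_mul _, ?_⟩
  rw [integral_const_mul, integral_Ioi_of_hasDerivAt_of_nonneg' hderiv hnonneg hlim]
  simp

open Real Set Filter Topology in
lemma integral_inv_norm_sub_mul_exp {b : ℝ} (hb : 0 < b) {x : EuclideanSpace ℝ (Fin 3)}
    (hx : x ≠ 0) :
    ∫ y, ‖x - y‖⁻¹ * exp (-b * ‖y‖ ^ 2) =
      2 * π / (√b * ‖x‖ * b) * ∫ s in (0 : ℝ)..(√b * ‖x‖), exp (-s ^ 2) := by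
  have ha : 0 < √b * ‖x‖ := mul_pos (sqrt_pos.2 hb) (norm_pos_iff.2 hx)
  have hsq : (√b * ‖x‖) ^ 2 = b * ‖x‖ ^ 2 := by rw [mul_pow, sq_sqrt hb.le]
  obtain ⟨hint, hval⟩ := integrableOn_and_integral_gaussian_product ha hb
  rw [hsq] at hint hval
  have hinv : ∀ y : EuclideanSpace ℝ (Fin 3), ‖x - y‖⁻¹ * exp (-b * ‖y‖ ^ 2) =
      2 / √π * ∫ t in Ioi (0 : ℝ), exp (-‖x - y‖ ^ 2 * t ^ 2) * exp (-b * ‖y‖ ^ 2) := by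
    intro y
    have hπ : 0 < √π := sqrt_pos.2 pi_pos
    rw [integral_mul_const, integral_gaussian_Ioi, sqrt_div pi_pos.le, sqrt_sq (norm_nonneg _)]
    field_simp
  have hprod : Integrable (Function.uncurry fun (y : EuclideanSpace ℝ (Fin 3)) (t : ℝ) =>
      exp (-‖x - y‖ ^ 2 * t ^ 2) * exp (-b * ‖y‖ ^ 2))
      (volume.prod (volume.restrict (Ioi 0))) := by
    refine (integrable_prod_iff' ?_).2 ⟨.of_forall fun t => ?_, ?_⟩
    · refine Continuous.aestronglyMeasurable ?_
      unfold Function.uncurry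
      fun_prop
    · refine not_imp_comm.1 integral_undef ?_
      simp only [Function.uncurry_apply_pair]
      rw [integral_exp_mul_exp hb]
      positivity
    · simp only [Function.uncurry_apply_pair, norm_mul, norm_eq_abs, abs_exp,
        integral_exp_mul_exp hb]
      exact hint
  simp_rw [hinv]
  rw [integral_const_mul, integral_integral_swap hprod]
  simp_rw [integral_exp_mul_exp hb]
  rw [hval]
  have hπ : 0 < √π := sqrt_pos.2 pi_pos
  field_simp

/-- The Coulomb potential of a centered isotropic Gaussian in ℝ³:
`∫ (1/(4π|x−y|)) ρ(y) dy = erf(r/(√2 σ))/(4πr)` with `r = |x|`. -/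
theorem stmt_14 (σ : ℝ) (hσ : 0 < σ)
    (ρ : EuclideanSpace ℝ (Fin 3) → ℝ)
    (hρ : ∀ y, ρ y = (1 / (σ ^ 3 * (2 * Real.pi) ^ ((3 : ℝ) / 2))) *
      Real.exp (-‖y‖ ^ 2 / (2 * σ ^ 2)))
    (x : EuclideanSpace ℝ (Fin 3)) (hx : x ≠ 0) :
    ∫ y, (1 / (4 * Real.pi * ‖x - y‖)) * ρ y =
      erf (‖x‖ / (Real.sqrt 2 * σ)) / (4 * Real.pi * ‖x‖) := by
  have hb : 0 < 1 / (2 * σ ^ 2) := by positivity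
  have hsb : √(1 / (2 * σ ^ 2)) = 1 / (√2 * σ) := by
    rw [Real.sqrt_div zero_le_one, Real.sqrt_one, Real.sqrt_mul zero_le_two, Real.sqrt_sq hσ.le]
  have hfun : ∀ y, (1 / (4 * Real.pi * ‖x - y‖)) * ρ y =
      (1 / (4 * Real.pi) * (1 / (σ ^ 3 * (2 * Real.pi) ^ ((3 : ℝ) / 2)))) *
        (‖x - y‖⁻¹ * Real.exp (-(1 / (2 * σ ^ 2)) * ‖y‖ ^ 2)) := by
    intro y
    rw [hρ, show -‖y‖ ^ 2 / (2 * σ ^ 2) = -(1 / (2 * σ ^ 2)) * ‖y‖ ^ 2 by ring, mul_comm (4 * _),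
      ← div_div, one_div ‖x - y‖]
    ring
  simp_rw [hfun]
  rw [integral_const_mul, integral_inv_norm_sub_mul_exp hb hx, hsb, erf,
    show 1 / (√2 * σ) * ‖x‖ = ‖x‖ / (√2 * σ) by ring, rpow_three_halves (by positivity),
    Real.sqrt_mul zero_le_two]
  have hr : 0 < ‖x‖ := norm_pos_iff.2 hx
  have hπ : 0 < √Real.pi := Real.sqrt_pos.2 Real.pi_pos
  have h2 : 0 < √(2 : ℝ) := Real.sqrt_pos.2 two_pos
  have h2' : √(2 : ℝ) ^ 2 = 2 := Real.sq_sqrt zero_le_two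
  field_simp
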